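/- Fix r₃ > 0. There exists α* < 0, depending only on r₃, such that for every pair 0 < r₁ < r₂ with r₂² − r₁² = r₃² and every α ∈ [α*, 0], one has μ₁^α(A_{r₁,r₂}) ≤ λ₁^α(B_{r₃}); that is, among all annuli of area π·r₃², the first Neumann–Robin eigenvalue is bounded above by the first Robin eigenvalue of the disk of the same area, uniformly for α in a fixed left neighbourhood of zero. -/

import Mathlib

open MeasureTheory Metric Filter Asymptotics Real RealInnerProductSpace

noncomputable section

abbrev Eu (d : ℕ) := EuclideanSpace ℝ (Fin d)

/-- The set of Rayleigh quotient values of nonzero Lipschitz test functions for the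
Robin problem with boundary parameter `α` on `Ω ⊆ ℝ^d`. -/
def robinRayleighSet (d : ℕ) (α : ℝ) (Ω : Set (Eu d)) : Set ℝ :=
  { lam : ℝ | ∃ (u : Eu d → ℝ) (K : NNReal),
      LipschitzOnWith K u (closure Ω) ∧
      (∫ x in Ω, (u x) ^ 2) ≠ 0 ∧
      lam = ((∫ x in Ω, ‖fderiv ℝ u x‖ ^ 2)
              + α * ∫ x in frontier Ω, (u x) ^ 2 ∂(μH[(d : ℝ) - 1]))
            / (∫ x in Ω, (u x) ^ 2) }

/-- The first Robin eigenvalue `λ₁^α(Ω)`, defined variationally. -/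
def robinEig (d : ℕ) (α : ℝ) (Ω : Set (Eu d)) : ℝ :=
  sInf (robinRayleighSet d α Ω)

/-- The first eigenvalue `μ₁^α(A_{r₁,r₂})` of the Laplacian on the planar annulus
`A_{r₁,r₂}` with Robin boundary condition (parameter `α`) on the outer circle and
Neumann condition on the inner circle, defined variationally. -/
def nrEig (α r₁ r₂ : ℝ) : ℝ :=
  sInf { lam : ℝ | ∃ ψ : ℝ → ℝ, ContDiff ℝ (⊤ : ℕ∞) ψ ∧
    (∫ r in r₁..r₂, (ψ r) ^ 2 * r) ≠ 0 ∧
    lam = ((∫ r in r₁..r₂, (deriv ψ r) ^ 2 * r) + α * r₂ * (ψ r₂) ^ 2)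
          / (∫ r in r₁..r₂, (ψ r) ^ 2 * r) }

/-- The entire function `∑ zⁿ / (n! (n + k)!)`, a rescaled modified Bessel function of order `k`. -/
def besselSeries (k : ℕ) (z : ℝ) : ℝ := ∑' n : ℕ, z ^ n / (n.factorial * (n + k).factorial)

lemma norm_besselSeries_term_le (k n : ℕ) (z : ℝ) :
    ‖z ^ n / (n.factorial * (n + k).factorial)‖ ≤ |z| ^ n / n.factorial := by
  have h : (1 : ℝ) ≤ (n + k).factorial := by exact_mod_cast (n + k).factorial_pos
  have h' : (0 : ℝ) < n.factorial := by positivity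
  rw [norm_div, norm_pow, Real.norm_eq_abs, Real.norm_eq_abs, abs_of_pos (mul_pos h' (by linarith))]
  gcongr
  nlinarith

lemma summable_besselSeries (k : ℕ) (z : ℝ) :
    Summable fun n : ℕ => z ^ n / (n.factorial * (n + k).factorial) :=
  .of_norm_bounded (Real.summable_pow_div_factorial |z|) fun n => norm_besselSeries_term_le k n z

lemma hasDerivAt_besselSeries (k : ℕ) (z : ℝ) :
    HasDerivAt (besselSeries k) (besselSeries (k + 1) z) z := by
  set R := |z| + 1
  have hz : z ∈ ball (0 : ℝ) R := by simp [R]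
  have hR : (0 : ℝ) ≤ R := by positivity
  have key := hasDerivAt_tsum_of_isPreconnected
    (g := fun (n : ℕ) (y : ℝ) => y ^ n / (n.factorial * (n + k).factorial))
    (g' := fun (n : ℕ) (y : ℝ) => n * y ^ (n - 1) / (n.factorial * (n + k).factorial))
    (u := fun n : ℕ => n * R ^ (n - 1) / n.factorial) (t := ball (0 : ℝ) R) (y₀ := z) (y := z)
    ?_ isOpen_ball (convex_ball _ _).isPreconnected ?_ ?_ hz (summable_besselSeries k z) hz
  · convert! key using 1
    rw [Summable.tsum_eq_zero_add]
    · simp only [besselSeries, Nat.cast_zero, zero_mul, zero_div, zero_add]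
      congr 1 with n
      have : ((n + 1).factorial : ℝ) = (n + 1) * n.factorial := by
        push_cast [Nat.factorial_succ]; ring
      rw [this, show n + 1 + k = n + (k + 1) by ring]
      push_cast
      field_simp
    · rw [← summable_nat_add_iff 1]
      refine (summable_besselSeries (k + 1) z).congr fun n => ?_
      have : ((n + 1).factorial : ℝ) = (n + 1) * n.factorial := by
        push_cast [Nat.factorial_succ]; ring
      rw [this, show n + 1 + k = n + (k + 1) by ring]
      push_cast
      field_simp
  · rw [← summable_nat_add_iff 1]
    refine (Real.summable_pow_div_factorial R).congr fun n => ?_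
    have : ((n + 1).factorial : ℝ) = (n + 1) * n.factorial := by
      push_cast [Nat.factorial_succ]; ring
    rw [this]
    push_cast
    field_simp
  · intro n y _
    exact (hasDerivAt_pow n y).div_const _
  · intro n y hy
    have hy' : |y| ≤ R := by simpa using (mem_ball_zero_iff.1 hy).le
    have h : (1 : ℝ) ≤ (n + k).factorial := by exact_mod_cast (n + k).factorial_pos
    have h' : (0 : ℝ) < n.factorial := by positivity
    rw [norm_div, norm_mul, norm_pow, Real.norm_eq_abs, Real.norm_eq_abs, Real.norm_eq_abs,
      abs_of_nonneg (Nat.cast_nonneg n), abs_of_pos (mul_pos h' (by linarith))]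
    gcongr
    nlinarith

lemma contDiff_besselSeries (k : ℕ) : ContDiff ℝ (⊤ : ℕ∞) (besselSeries k) := by
  rw [contDiff_infty]
  intro n
  induction n generalizing k with
  | zero =>
    exact contDiff_zero.2 (continuous_iff_continuousAt.2 fun z =>
      (hasDerivAt_besselSeries k z).continuousAt)
  | succ n ih =>
    have h : deriv (besselSeries k) = besselSeries (k + 1) :=
      funext fun z => (hasDerivAt_besselSeries k z).deriv
    push_cast
    rw [contDiff_succ_iff_deriv]
    refine ⟨fun z => (hasDerivAt_besselSeries k z).differentiableAt, by simp, ?_⟩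
    rw [h]
    exact ih (k + 1)

lemma continuous_besselSeries (k : ℕ) : Continuous (besselSeries k) :=
  (contDiff_besselSeries k).continuous

lemma besselSeries_zero_eq (z : ℝ) :
    besselSeries 0 z = besselSeries 1 z + z * besselSeries 2 z := by
  unfold besselSeries
  rw [← tsum_mul_left, (summable_besselSeries 0 z).tsum_eq_zero_add,
    (summable_besselSeries 1 z).tsum_eq_zero_add, add_assoc, ← Summable.tsum_add]
  · congr 1
    refine tsum_congr fun n => ?_
    have h1 : ((n + 1).factorial : ℝ) = (n + 1) * n.factorial := by
      push_cast [Nat.factorial_succ]; ring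
    have h2 : ((n + 1 + 1).factorial : ℝ) = (n + 2) * ((n + 1) * n.factorial) := by
      push_cast [Nat.factorial_succ]; ring
    rw [show n + 2 = n + 1 + 1 by ring, add_zero, h2, h1]
    field_simp
    ring
  · exact (summable_nat_add_iff 1).2 (summable_besselSeries 1 z)
  · exact (summable_besselSeries 2 z).mul_left z

lemma besselSeries_succ_le (k : ℕ) {z : ℝ} (hz : 0 ≤ z) :
    besselSeries (k + 1) z ≤ besselSeries k z := by
  refine (summable_besselSeries (k + 1) z).tsum_le_tsum (fun n => ?_) (summable_besselSeries k z)
  gcongr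
  omega

lemma besselSeries_mono (k : ℕ) {y z : ℝ} (hy : 0 ≤ y) (hyz : y ≤ z) :
    besselSeries k y ≤ besselSeries k z := by
  refine (summable_besselSeries k y).tsum_le_tsum (fun n => ?_) (summable_besselSeries k z)
  gcongr

lemma besselSeries_pos (k : ℕ) {z : ℝ} (hz : 0 ≤ z) : 0 < besselSeries k z :=
  (summable_besselSeries k z).tsum_pos (fun n => by positivity) 0 (by positivity)

/-- For `0 ≤ b ≤ 1/6`, the Robin condition for the disk can be solved with `b ≥ z`. -/
lemma exists_bessel_robin {b : ℝ} (hb : b ∈ Set.Icc (0 : ℝ) (1 / 6)) :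
    ∃ z ∈ Set.Icc (0 : ℝ) (1 / 6), 2 * z * besselSeries 1 z = b * besselSeries 0 z ∧ z ≤ b := by
  have hle : ∀ z ∈ Set.Icc (0 : ℝ) (1 / 6), z * besselSeries 0 z ≤ 2 * z * besselSeries 1 z := by
    intro z hz
    have h1 := besselSeries_zero_eq z
    have h2 := besselSeries_succ_le 1 hz.1
    have h3 := besselSeries_pos 2 hz.1
    have h4 := besselSeries_pos 1 hz.1
    have : besselSeries 0 z ≤ 2 * besselSeries 1 z := by
      norm_num at h2
      nlinarith [hz.2]
    nlinarith [hz.1]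
  have hcont : ContinuousOn (fun z => 2 * z * besselSeries 1 z - b * besselSeries 0 z)
      (Set.Icc 0 (1 / 6)) := by
    have := continuous_besselSeries
    fun_prop
  have h1 := hle (1 / 6) (by norm_num)
  have h2 := besselSeries_pos 0 (le_refl (0 : ℝ))
  have h3 := besselSeries_pos 0 (show (0 : ℝ) ≤ 1 / 6 by norm_num)
  obtain ⟨z, hz, h⟩ := intermediate_value_Icc (by norm_num) hcont
    (show (0 : ℝ) ∈ Set.Icc _ _ from ⟨by nlinarith [hb.1], by nlinarith [hb.2]⟩)
  have h0 : 2 * z * besselSeries 1 z = b * besselSeries 0 z := by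
    simp only at h; linarith
  refine ⟨z, hz, h0, ?_⟩
  have := hle z hz
  rw [h0] at this
  exact le_of_mul_le_mul_right this (besselSeries_pos 0 hz.1)

/-- The Rayleigh quotients defining `nrEig` on a genuine annulus are bounded below. -/
lemma bddBelow_nrRayleigh {α r₁ r₂ : ℝ} (hα : α ≤ 0) (h₁ : 0 < r₁) (h₁₂ : r₁ < r₂) :
    BddBelow { lam : ℝ | ∃ ψ : ℝ → ℝ, ContDiff ℝ (⊤ : ℕ∞) ψ ∧
      (∫ r in r₁..r₂, (ψ r) ^ 2 * r) ≠ 0 ∧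
      lam = ((∫ r in r₁..r₂, (deriv ψ r) ^ 2 * r) + α * r₂ * (ψ r₂) ^ 2)
            / (∫ r in r₁..r₂, (ψ r) ^ 2 * r) } := by
  set B := -α * r₂ with hB
  have hB0 : 0 ≤ B := mul_nonneg (by linarith) (by linarith)
  set m := B / (r₂ - r₁) with hm
  have hd : 0 < r₂ - r₁ := by linarith
  have hm0 : 0 ≤ m := by positivity
  have hmB : m * (r₂ - r₁) = B := by rw [hm]; field_simp
  set C := (B / r₁) ^ 2 + m / r₁ with hC
  refine ⟨-C, ?_⟩
  rintro _ ⟨ψ, hψ, h0, rfl⟩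
  have hψc : Continuous ψ := hψ.continuous
  have hψ'c : Continuous (deriv ψ) := hψ.continuous_deriv (by simp)
  have hψd : ∀ r, HasDerivAt ψ (deriv ψ r) r := fun r =>
    ((hψ.differentiable (by simp)) r).hasDerivAt
  have hpos : 0 < ∫ r in r₁..r₂, (ψ r) ^ 2 * r :=
    lt_of_le_of_ne (intervalIntegral.integral_nonneg h₁₂.le fun r hr =>
      mul_nonneg (sq_nonneg _) (h₁.le.trans hr.1)) (Ne.symm h0)
  rw [le_div_iff₀ hpos]
  have hint1 : IntervalIntegrable (fun r => (deriv ψ r) ^ 2 * r) volume r₁ r₂ :=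
    Continuous.intervalIntegrable (by fun_prop) _ _
  have hint2 : IntervalIntegrable (fun r => C * ((ψ r) ^ 2 * r)) volume r₁ r₂ :=
    Continuous.intervalIntegrable (by fun_prop) _ _
  have hFTC := intervalIntegral.integral_eq_sub_of_hasDerivAt (a := r₁) (b := r₂)
    (f := fun r => (ψ r) ^ 2 * (m * (r - r₁)))
    (f' := fun r => (2 * ψ r * deriv ψ r) * (m * (r - r₁)) + (ψ r) ^ 2 * m)
    (fun r _ => by
      convert! ((hψd r).pow 2).mul (((hasDerivAt_id r).sub_const r₁).const_mul m) using 1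
      simp) (Continuous.intervalIntegrable (by fun_prop) _ _)
  have hmono := intervalIntegral.integral_mono_on h₁₂.le
    (Continuous.intervalIntegrable (by fun_prop) _ _ :
      IntervalIntegrable (fun r => (2 * ψ r * deriv ψ r) * (m * (r - r₁)) + (ψ r) ^ 2 * m)
        volume r₁ r₂) (hint1.add hint2) (fun r hr => by
      have hr0 : 0 < r := h₁.trans_le hr.1
      have hMB : m * (r - r₁) ≤ B := by rw [← hmB]; gcongr; exact hr.2
      have hM0 : 0 ≤ m * (r - r₁) := mul_nonneg hm0 (by linarith [hr.1])
      have e1 : (m * (r - r₁)) ≤ (B / r₁) * r := by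
        have : B ≤ (B / r₁) * r := by
          rw [div_mul_eq_mul_div, le_div_iff₀ h₁]; gcongr; exact hr.1
        linarith
      have e2 : m ≤ m / r₁ * r := by
        rw [div_mul_eq_mul_div, le_div_iff₀ h₁]; gcongr; exact hr.1
      have e3 : (2 * ψ r * deriv ψ r) * (m * (r - r₁)) ≤
          (deriv ψ r) ^ 2 * r + (B / r₁) ^ 2 * ((ψ r) ^ 2 * r) := by
        set M := m * (r - r₁)
        have q : M = (M / r) * r := by field_simp
        have q2 : M / r ≤ B / r₁ := by rwa [div_le_iff₀ hr0]
        have q3 : (M / r) ^ 2 ≤ (B / r₁) ^ 2 := by gcongr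
        have q4 : 0 ≤ (deriv ψ r - ψ r * (M / r)) ^ 2 * r := by positivity
        have q5 := mul_le_mul_of_nonneg_right q3 (show 0 ≤ (ψ r) ^ 2 * r by positivity)
        rw [q]
        nlinarith
      have e4 := mul_le_mul_of_nonneg_left e2 (sq_nonneg (ψ r))
      simp only [hC]
      nlinarith)
  rw [intervalIntegral.integral_add hint1 hint2, intervalIntegral.integral_const_mul, hFTC,
    hmB] at hmono
  simp only [sub_self, mul_zero, sub_zero] at hmono
  have : α * r₂ * (ψ r₂) ^ 2 = - ((ψ r₂) ^ 2 * B) := by rw [hB]; ring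
  rw [this]
  linarith

lemma nrEig_le_of_test {α r₁ r₂ : ℝ} (hα : α ≤ 0) (h₁ : 0 < r₁) (h₁₂ : r₁ < r₂)
    {ψ : ℝ → ℝ} (hψ : ContDiff ℝ (⊤ : ℕ∞) ψ) (hpos : ∀ r ∈ Set.Icc r₁ r₂, 0 < ψ r) {lam : ℝ}
    (h : (∫ r in r₁..r₂, (deriv ψ r) ^ 2 * r) + α * r₂ * (ψ r₂) ^ 2 ≤
      lam * ∫ r in r₁..r₂, (ψ r) ^ 2 * r) :
    nrEig α r₁ r₂ ≤ lam := by
  have hψc : Continuous ψ := hψ.continuous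
  have h0 : 0 < ∫ r in r₁..r₂, (ψ r) ^ 2 * r :=
    intervalIntegral.intervalIntegral_pos_of_pos_on
      (Continuous.intervalIntegrable (by fun_prop) _ _)
      (fun r hr => mul_pos (pow_pos (hpos r ⟨hr.1.le, hr.2.le⟩) 2) (h₁.trans hr.1)) h₁₂
  refine (csInf_le (bddBelow_nrRayleigh hα h₁ h₁₂) ⟨ψ, hψ, h0.ne', rfl⟩).trans ?_
  rwa [div_le_iff₀ h0]

lemma nrEig_le_of_const {α r₁ r₂ : ℝ} (hα : α ≤ 0) (h₁ : 0 < r₁) (h₁₂ : r₁ < r₂) :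
    nrEig α r₁ r₂ ≤ 2 * α * r₂ / (r₂ ^ 2 - r₁ ^ 2) := by
  have hd : 0 < r₂ ^ 2 - r₁ ^ 2 := by nlinarith
  refine nrEig_le_of_test hα h₁ h₁₂ (ψ := fun _ => 1) contDiff_const (fun _ _ => one_pos) ?_
  simp
  field_simp
  exact le_rfl

/-- Transplanting the radial ground state of the disk to an annulus of the same area. -/
lemma nrEig_le_of_bessel {β c r₁ r₂ r₃ : ℝ} (hβ : 0 ≤ β) (hc : 0 ≤ c) (h₁ : 0 < r₁)
    (h₁₂ : r₁ < r₂) (h₃ : 0 < r₃) (harea : r₂ ^ 2 - r₁ ^ 2 = r₃ ^ 2)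
    (hrobin : 2 * (c * r₃ ^ 2) * besselSeries 1 (c * r₃ ^ 2) =
      β * r₃ * besselSeries 0 (c * r₃ ^ 2))
    (hsmall : 2 * c ^ 2 * r₃ ^ 2 * (r₂ + r₃) ≤ β) :
    nrEig (-β) r₁ r₂ ≤ -(4 * c) := by
  set τ : ℝ → ℝ := fun r => c * (r ^ 2 - r₁ ^ 2) with hτ
  have hτd : ∀ r, HasDerivAt τ (2 * c * r) r := fun r => by
    convert! (((hasDerivAt_id r).pow 2).sub_const (r₁ ^ 2)).const_mul c using 1
    simp; ring
  have hE : ∀ k r, HasDerivAt (fun r => besselSeries k (τ r))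
      (besselSeries (k + 1) (τ r) * (2 * c * r)) r := fun k r =>
    (hasDerivAt_besselSeries k (τ r)).comp r (hτd r)
  have hcont := continuous_besselSeries
  have hτc : Continuous τ := by fun_prop
  have hτ0 : ∀ r ∈ Set.Icc r₁ r₂, 0 ≤ τ r := fun r hr =>
    mul_nonneg hc (by nlinarith [hr.1])
  have hτ2 : τ r₂ = c * r₃ ^ 2 := by simp only [hτ, harea]
  have hτle : ∀ r ∈ Set.Icc r₁ r₂, τ r ≤ c * r₃ ^ 2 := fun r hr => by
    rw [← hτ2]; simp only [hτ]; gcongr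
    · linarith [hr.1]
    · exact hr.2
  set M := besselSeries 0 (c * r₃ ^ 2) with hM
  refine nrEig_le_of_test (by linarith) h₁ h₁₂ (ψ := fun r => besselSeries 0 (τ r))
    ((contDiff_besselSeries 0).comp (by fun_prop)) (fun r hr => besselSeries_pos 0 (hτ0 r hr)) ?_
  have hder : deriv (fun r => besselSeries 0 (τ r)) =
      fun r => besselSeries 1 (τ r) * (2 * c * r) := funext fun r => (hE 0 r).deriv
  rw [hder]
  have hFTC := intervalIntegral.integral_eq_sub_of_hasDerivAt (a := r₁) (b := r₂)
    (f := fun r => 2 * τ r * (besselSeries 1 (τ r) * besselSeries 0 (τ r))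
      + 2 * c ^ 2 * r₁ ^ 2 * M ^ 2 * r ^ 2)
    (f' := fun r => 4 * c * r * (besselSeries 0 (τ r) ^ 2 + τ r * besselSeries 1 (τ r) ^ 2)
      + 4 * c ^ 2 * r₁ ^ 2 * M ^ 2 * r)
    (fun r _ => by
      convert! (((hτd r).const_mul 2).mul ((hE 1 r).mul (hE 0 r))).add
        (((hasDerivAt_id r).pow 2).const_mul (2 * c ^ 2 * r₁ ^ 2 * M ^ 2)) using 1
      have := besselSeries_zero_eq (τ r)
      have h2 : besselSeries 0 (τ r) ^ 2 =
        besselSeries 0 (τ r) * (besselSeries 1 (τ r) + τ r * besselSeries 2 (τ r)) := by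
        rw [← this, sq]
      rw [h2]
      simp
      ring) (Continuous.intervalIntegrable (by fun_prop) _ _)
  have hint1 : IntervalIntegrable (fun r => (besselSeries 1 (τ r) * (2 * c * r)) ^ 2 * r)
      volume r₁ r₂ := Continuous.intervalIntegrable (by fun_prop) _ _
  have hint2 : IntervalIntegrable (fun r => 4 * c * (besselSeries 0 (τ r) ^ 2 * r))
      volume r₁ r₂ := Continuous.intervalIntegrable (by fun_prop) _ _
  have hmono := intervalIntegral.integral_mono_on h₁₂.le (hint1.add hint2)
    (Continuous.intervalIntegrable (by fun_prop) _ _ : IntervalIntegrable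
      (fun r => 4 * c * r * (besselSeries 0 (τ r) ^ 2 + τ r * besselSeries 1 (τ r) ^ 2)
        + 4 * c ^ 2 * r₁ ^ 2 * M ^ 2 * r) volume r₁ r₂) (fun r hr => by
      have hr0 : 0 < r := h₁.trans_le hr.1
      have h4 : besselSeries 1 (τ r) ≤ M :=
        (besselSeries_succ_le 0 (hτ0 r hr)).trans (besselSeries_mono 0 (hτ0 r hr) (hτle r hr))
      have h5 : besselSeries 1 (τ r) ^ 2 ≤ M ^ 2 :=
        pow_le_pow_left₀ (besselSeries_pos 1 (hτ0 r hr)).le h4 2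
      have h6 := mul_le_mul_of_nonneg_left h5
        (show 0 ≤ 4 * c ^ 2 * r₁ ^ 2 * r by positivity)
      have h7 : τ r = c * (r ^ 2 - r₁ ^ 2) := rfl
      have h8 : 4 * c * r * (τ r * besselSeries 1 (τ r) ^ 2) =
        4 * c * r * (c * (r ^ 2 - r₁ ^ 2) * besselSeries 1 (τ r) ^ 2) := by rw [← h7]
      linarith)
  rw [intervalIntegral.integral_add hint1 hint2, intervalIntegral.integral_const_mul, hFTC] at hmono
  have hτ1 : τ r₁ = 0 := by simp [hτ]
  simp only [hτ1, hτ2, ← hM] at hmono ⊢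
  have h9 : 2 * c ^ 2 * r₃ ^ 2 * r₁ ^ 2 ≤ β * (r₂ - r₃) := by
    have h23 : 0 ≤ r₂ - r₃ := by nlinarith
    have := mul_le_mul_of_nonneg_right hsmall h23
    have h10 : r₁ ^ 2 = (r₂ + r₃) * (r₂ - r₃) := by linear_combination -harea
    rw [h10]
    linarith
  have h11 := mul_le_mul_of_nonneg_right h9 (sq_nonneg M)
  have h12 : 2 * (c * r₃ ^ 2) * (besselSeries 1 (c * r₃ ^ 2) * M) = β * r₃ * M * M := by
    rw [← hrobin]; ring
  have h13 : r₂ ^ 2 = r₁ ^ 2 + r₃ ^ 2 := by linarith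
  rw [h12, h13] at hmono
  linarith

/-- Hardy-type inequality along a ray, with the logarithmic derivative of the ground state. -/
lemma bessel_ray_inequality {c R b : ℝ} (hc : 0 ≤ c) (hR : 0 < R)
    (hrobin : 2 * (c * R ^ 2) * besselSeries 1 (c * R ^ 2) = b * besselSeries 0 (c * R ^ 2))
    {v D : ℝ → ℝ} {K : NNReal} (hv : LipschitzWith K v)
    (hD : ∀ᵐ r, r ∈ Set.Ioo 0 R → ∃ d, HasDerivAt v d r ∧ d ^ 2 ≤ D r)
    (hDint : IntegrableOn (fun r => r * (D r + 4 * c * v r ^ 2)) (Set.Ioo 0 R)) :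
    b * v R ^ 2 ≤ ∫ r in Set.Ioo 0 R, r * (D r + 4 * c * v r ^ 2) := by
  set τ : ℝ → ℝ := fun r => c * r ^ 2 with hτ
  have hτd : ∀ r, HasDerivAt τ (2 * c * r) r := fun r => by
    convert! ((hasDerivAt_id r).pow 2).const_mul c using 1
    simp; ring
  have hτ0 : ∀ r, 0 ≤ τ r := fun r => by positivity
  have hE : ∀ k r, HasDerivAt (fun r => besselSeries k (τ r))
      (besselSeries (k + 1) (τ r) * (2 * c * r)) r := fun k r =>
    (hasDerivAt_besselSeries k (τ r)).comp r (hτd r)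
  have hE0 : ∀ r, besselSeries 0 (τ r) ≠ 0 := fun r => (besselSeries_pos 0 (hτ0 r)).ne'
  set q : ℝ → ℝ := fun r => 2 * c * besselSeries 1 (τ r) / besselSeries 0 (τ r) with hq
  set G : ℝ → ℝ := fun r => r ^ 2 * q r with hG
  have hGd : ∀ r, HasDerivAt G (r * (4 * c - (r * q r) ^ 2)) r := fun r => by
    convert! ((hasDerivAt_id r).pow 2).mul (((hE 1 r).const_mul (2 * c)).div (hE 0 r) (hE0 r))
      using 1
    have := besselSeries_zero_eq (τ r)
    have h2 : c * r ^ 2 * besselSeries 2 (τ r) = besselSeries 0 (τ r) - besselSeries 1 (τ r) := by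
      rw [this]; ring
    have h0 := hE0 r
    simp only [hq]
    simp only [Nat.cast_ofNat, Nat.add_one_sub_one, pow_one, id_eq, mul_one, Pi.pow_apply,
      Pi.div_apply, Nat.reduceAdd]
    field_simp
    linear_combination (-4 * r * c * besselSeries 0 (τ r)) * h2
  have hGc : ContDiff ℝ 1 G := by
    have h0 : ContDiff ℝ 1 (fun r => besselSeries 0 (τ r)) :=
      ((contDiff_besselSeries 0).of_le (by simp)).comp (by fun_prop)
    have h1 : ContDiff ℝ 1 (fun r => besselSeries 1 (τ r)) :=
      ((contDiff_besselSeries 1).of_le (by simp)).comp (by fun_prop)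
    exact (contDiff_id.pow 2).mul ((contDiff_const.mul h1).div h0 hE0)
  have hvAC : AbsolutelyContinuousOnInterval v 0 R :=
    (hv.lipschitzOnWith (s := Set.uIcc 0 R)).absolutelyContinuousOnInterval
  have hWAC : AbsolutelyContinuousOnInterval (v * v * G) 0 R :=
    (hvAC.mul hvAC).mul hGc.contDiffOn.absolutelyContinuousOnInterval
  have hFTC := hWAC.integral_deriv_eq_sub
  have hWint := hWAC.intervalIntegrable_deriv
  rw [intervalIntegrable_iff_integrableOn_Ioo_of_le hR.le] at hWint
  rw [intervalIntegral.integral_of_le hR.le, integral_Ioc_eq_integral_Ioo] at hFTC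
  have hGR : G R = b := by
    have h0 := hE0 R
    simp only [hG, hq]
    simp only [hτ] at h0 ⊢
    rw [← mul_div_assoc, div_eq_iff h0, ← hrobin]
    ring
  have hle : ∀ᵐ r ∂(volume.restrict (Set.Ioo 0 R)),
      deriv (v * v * G) r ≤ r * (D r + 4 * c * v r ^ 2) := by
    rw [ae_restrict_iff' measurableSet_Ioo]
    filter_upwards [hD] with r hr hrm
    obtain ⟨d, hd, hdD⟩ := hr hrm
    rw [((hd.mul hd).mul (hGd r)).deriv]
    simp only [hG, Pi.mul_apply]
    have h1 : 0 ≤ r * (d - v r * (r * q r)) ^ 2 := mul_nonneg hrm.1.le (sq_nonneg _)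
    have h2 := mul_le_mul_of_nonneg_left hdD hrm.1.le
    linarith
  have hmono := integral_mono_ae hWint hDint hle
  rw [hFTC] at hmono
  simp only [Pi.mul_apply, hGR] at hmono
  have hG0 : G 0 = 0 := by simp [hG]
  rw [hG0] at hmono
  linarith

/-- Polar coordinates in the Euclidean plane. -/
def polarPoint (p : ℝ × ℝ) : Eu 2 := !₂[p.1 * cos p.2, p.1 * sin p.2]

lemma continuous_polarPoint : Continuous polarPoint := by
  unfold polarPoint
  fun_prop

lemma polarPoint_eq_smul (r θ : ℝ) : polarPoint (r, θ) = r • polarPoint (1, θ) := by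
  ext i; fin_cases i <;> simp [polarPoint]

lemma norm_polarPoint (r θ : ℝ) : ‖polarPoint (r, θ)‖ = |r| := by
  rw [EuclideanSpace.norm_eq, ← Real.sqrt_sq_eq_abs]
  congr 1
  simp [polarPoint, mul_pow]
  rw [← mul_add, cos_sq_add_sin_sq, mul_one]

lemma measurePreserving_euclidean_of_prod :
    MeasurePreserving (fun p : ℝ × ℝ => (!₂[p.1, p.2] : Eu 2)) := by
  have h := (PiLp.volume_preserving_toLp (Fin 2)).comp
    (volume_preserving_finTwoArrow ℝ).symm
  exact h

lemma measurableEmbedding_euclidean_of_prod :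
    MeasurableEmbedding (fun p : ℝ × ℝ => (!₂[p.1, p.2] : Eu 2)) :=
  ((MeasurableEquiv.finTwoArrow (α := ℝ)).symm.trans
    (MeasurableEquiv.toLp 2 (Fin 2 → ℝ))).measurableEmbedding

lemma setIntegral_ball_eq_polar {R : ℝ} (g : Eu 2 → ℝ) :
    ∫ x in ball (0 : Eu 2) R, g x =
      ∫ p in Set.Ioo 0 R ×ˢ Set.Ioo (-π) π, p.1 * g (polarPoint p) := by
  rw [← integral_indicator measurableSet_ball,
    ← measurePreserving_euclidean_of_prod.integral_comp measurableEmbedding_euclidean_of_prod,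
    ← integral_comp_polarCoord_symm, ← integral_indicator polarCoord.open_target.measurableSet,
    ← integral_indicator (measurableSet_Ioo.prod measurableSet_Ioo)]
  congr 1 with p
  have hp : (!₂[(polarCoord.symm p).1, (polarCoord.symm p).2] : Eu 2) = polarPoint p := by
    simp [polarPoint, polarCoord_symm_apply]
  by_cases h : p ∈ polarCoord.target
  · rw [Set.indicator_of_mem h, hp]
    rw [polarCoord_target] at h
    have hpos : 0 < p.1 := h.1
    by_cases hR : p.1 < R
    · rw [Set.indicator_of_mem, Set.indicator_of_mem, smul_eq_mul]
      · exact ⟨⟨hpos, hR⟩, h.2⟩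
      · rw [mem_ball_zero_iff, ← Prod.mk.eta (p := p), norm_polarPoint, abs_of_pos hpos]
        exact hR
    · rw [Set.indicator_of_notMem, Set.indicator_of_notMem, smul_zero]
      · exact fun h' => hR h'.1.2
      · rw [mem_ball_zero_iff, ← Prod.mk.eta (p := p), norm_polarPoint, abs_of_pos hpos]
        exact hR
  · rw [Set.indicator_of_notMem h, Set.indicator_of_notMem]
    rw [polarCoord_target] at h
    exact fun h' => h ⟨h'.1.1, h'.2⟩

lemma ae_polar_of_ae {P : Eu 2 → Prop} (hP : MeasurableSet {x | P x}) (h : ∀ᵐ x, P x) :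
    ∀ᵐ p ∂(volume.restrict (Set.Ioi (0 : ℝ) ×ˢ Set.Ioo (-π) π)), P (polarPoint p) := by
  have h' : ∀ᵐ p : ℝ × ℝ, P (!₂[p.1, p.2]) :=
    measurePreserving_euclidean_of_prod.quasiMeasurePreserving.ae h
  set N : Set (ℝ × ℝ) := {p | ¬ P (!₂[p.1, p.2])}
  have hN : MeasurableSet N := measurePreserving_euclidean_of_prod.measurable hP.compl
  have hN0 : volume N = 0 := h'
  have key := lintegral_comp_polarCoord_symm (N.indicator fun _ => 1)
  rw [lintegral_indicator hN, setLIntegral_const, hN0, mul_zero, polarCoord_target] at key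
  have hmeas : Measurable fun p : ℝ × ℝ => polarCoord.symm p := by
    simp only [polarCoord_symm_apply]
    fun_prop
  rw [lintegral_eq_zero_iff] at key
  · have hpos : ∀ᵐ p ∂(volume.restrict (Set.Ioi (0 : ℝ) ×ˢ Set.Ioo (-π) π)), 0 < p.1 := by
      filter_upwards [ae_restrict_mem (measurableSet_Ioi.prod measurableSet_Ioo)] with p hp
      exact hp.1
    filter_upwards [key, hpos] with p hp hp1
    by_contra hcon
    have hmem : polarCoord.symm p ∈ N := by
      simpa [N, polarCoord_symm_apply, polarPoint] using hcon
    have hp' : ENNReal.ofReal p.1 • N.indicator (fun _ => (1 : ENNReal)) (polarCoord.symm p) = 0 := hp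
    rw [Set.indicator_of_mem hmem] at hp'
    simp only [smul_eq_mul, mul_one, ENNReal.ofReal_eq_zero] at hp'
    linarith
  · exact (measurable_fst.ennreal_ofReal).smul
      ((measurable_const.indicator hN).comp hmeas)

/-- The perimeter measure of a circle is dominated by its arc-length parametrisation. -/
lemma hausdorff_circle_le {R : ℝ} (hR : 0 < R) :
    (μH[1] : Measure (Eu 2)).restrict (sphere 0 R) ≤
      ENNReal.ofReal R • (volume.restrict (Set.Ioc (-π) π)).map fun θ => polarPoint (R, θ) := by
  have hcont : Continuous fun θ => polarPoint (R, θ) :=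
    continuous_polarPoint.comp (by fun_prop)
  have hlip : LipschitzWith R.toNNReal fun θ => polarPoint (R, θ) := by
    refine LipschitzWith.of_dist_le_mul fun a b => ?_
    rw [EuclideanSpace.dist_eq, Real.coe_toNNReal _ hR.le, Real.dist_eq]
    refine Real.sqrt_le_iff.2 ⟨by positivity, ?_⟩
    simp only [polarPoint, Fin.sum_univ_two, Real.dist_eq, sq_abs, mul_pow]
    have h := Real.one_sub_sq_div_two_le_cos (x := a - b)
    rw [cos_sub] at h
    have h' := mul_le_mul_of_nonneg_left h (sq_nonneg R)
    simp
    nlinarith [sin_sq_add_cos_sq a, sin_sq_add_cos_sq b]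
  refine Measure.le_iff.2 fun s hs => ?_
  have hsub : s ∩ sphere 0 R ⊆ (fun θ => polarPoint (R, θ)) ''
      ((fun θ => polarPoint (R, θ)) ⁻¹' s ∩ Set.Ioc (-π) π) := by
    rintro x ⟨hxs, hx⟩
    set z : ℂ := ⟨x 0, x 1⟩ with hz
    have hzn : ‖z‖ = R := by
      rw [mem_sphere_zero_iff_norm, EuclideanSpace.norm_eq, Fin.sum_univ_two] at hx
      rw [Complex.norm_eq_sqrt_sq_add_sq, ← hx]
      simp [hz]
    have hpx : polarPoint (R, z.arg) = x := by
      have h1 := Complex.norm_mul_cos_arg z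
      have h2 := Complex.norm_mul_sin_arg z
      rw [hzn] at h1 h2
      ext i
      fin_cases i
      · simpa [polarPoint] using h1
      · simpa [polarPoint] using h2
    exact ⟨z.arg, ⟨by simpa [hpx] using hxs, Complex.arg_mem_Ioc z⟩, hpx⟩
  rw [Measure.restrict_apply hs, Measure.smul_apply, Measure.map_apply hcont.measurable hs,
    Measure.restrict_apply (hcont.measurable hs)]
  calc _ ≤ _ := measure_mono hsub
    _ ≤ _ := hlip.hausdorffMeasure_image_le zero_le_one _
    _ = _ := by
      rw [hausdorffMeasure_real, ENNReal.rpow_one]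
      rfl

lemma robin_form_ball_lower {c R β : ℝ} (hc : 0 ≤ c) (hR : 0 < R) (hβ : 0 ≤ β)
    (hrobin : 2 * (c * R ^ 2) * besselSeries 1 (c * R ^ 2) = β * R * besselSeries 0 (c * R ^ 2))
    {g : Eu 2 → ℝ} {K : NNReal} (hg : LipschitzWith K g) :
    β * ∫ x in sphere (0 : Eu 2) R, g x ^ 2 ∂(μH[1]) ≤
      (∫ x in ball (0 : Eu 2) R, ‖fderiv ℝ g x‖ ^ 2) +
        4 * c * ∫ x in ball (0 : Eu 2) R, g x ^ 2 := by
  have hgc := hg.continuous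
  have hfd : Measurable fun x => ‖fderiv ℝ g x‖ ^ 2 := (measurable_fderiv ℝ g).norm.pow_const 2
  have hfdb : ∀ x, ‖fderiv ℝ g x‖ ^ 2 ≤ (K : ℝ) ^ 2 := fun x =>
    pow_le_pow_left₀ (norm_nonneg _) (norm_fderiv_le_of_lipschitz ℝ hg) 2
  have hgb : ∀ x ∈ ball (0 : Eu 2) R, g x ^ 2 ≤ (|g 0| + K * R) ^ 2 := fun x hx => by
    rw [← sq_abs]
    refine pow_le_pow_left₀ (abs_nonneg _) ?_ 2
    have h1 := hg.dist_le_mul x 0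
    have h2 : (K : ℝ) * dist x 0 ≤ K * R := by gcongr; exact (mem_ball.1 hx).le
    rw [Real.dist_eq] at h1
    have h3 := abs_sub_abs_le_abs_sub (g x) (g 0)
    linarith
  have hball : volume (ball (0 : Eu 2) R) ≠ ⊤ := measure_ball_lt_top.ne
  have hi1 : IntegrableOn (fun x => ‖fderiv ℝ g x‖ ^ 2) (ball (0 : Eu 2) R) :=
    IntegrableOn.of_bound hball.lt_top hfd.aestronglyMeasurable ((K : ℝ) ^ 2)
      (.of_forall fun x => by
        rw [Real.norm_of_nonneg (sq_nonneg _)]; exact hfdb x)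
  have hi2 : IntegrableOn (fun x => 4 * c * g x ^ 2) (ball (0 : Eu 2) R) :=
    (ContinuousOn.integrableOn_compact (isCompact_closedBall (0 : Eu 2) R)
      (by fun_prop)).mono_set ball_subset_closedBall
  rw [← integral_const_mul (4 * c), ← integral_add hi1 hi2, setIntegral_ball_eq_polar]
  set J : ℝ × ℝ → ℝ := fun p =>
    p.1 * (‖fderiv ℝ g (polarPoint p)‖ ^ 2 + 4 * c * g (polarPoint p) ^ 2) with hJ
  have hJm : Measurable J := by
    have hp := continuous_polarPoint.measurable
    exact measurable_fst.mul ((hfd.comp hp).add (((hgc.measurable.comp hp).pow_const 2).const_mul _))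
  set C := R * ((K : ℝ) ^ 2 + 4 * c * (|g 0| + K * R) ^ 2) with hC
  have hJb : ∀ p : ℝ × ℝ, p.1 ∈ Set.Ioo 0 R → ‖J p‖ ≤ C := fun p hp => by
    have hp0 := hp.1
    rw [Real.norm_of_nonneg (by positivity)]
    simp only [hJ, hC]
    have hmem : polarPoint p ∈ ball (0 : Eu 2) R := by
      rw [mem_ball_zero_iff, ← Prod.mk.eta (p := p), norm_polarPoint, abs_of_pos hp0]
      exact hp.2
    exact mul_le_mul hp.2.le (add_le_add (hfdb _)
      (mul_le_mul_of_nonneg_left (hgb _ hmem) (by positivity))) (by positivity) hR.le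
  have hJi : Integrable J ((volume.restrict (Set.Ioo 0 R)).prod
      (volume.restrict (Set.Ioo (-π) π))) := by
    rw [Measure.prod_restrict, ← Measure.volume_eq_prod]
    refine IntegrableOn.of_bound ?_ hJm.aestronglyMeasurable C ?_
    · rw [Measure.volume_eq_prod, Measure.prod_prod]
      exact ENNReal.mul_lt_top (by simp) (by simp)
    · filter_upwards [ae_restrict_mem (measurableSet_Ioo.prod measurableSet_Ioo)] with p hp
      exact hJb p hp.1
  have hJs : ∀ θ, IntegrableOn (fun r => J (r, θ)) (Set.Ioo 0 R) := fun θ =>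
    IntegrableOn.of_bound (by simp) (hJm.comp (by fun_prop)).aestronglyMeasurable C (by
      filter_upwards [ae_restrict_mem measurableSet_Ioo] with r hr
      exact hJb (r, θ) hr)
  rw [Measure.volume_eq_prod, ← Measure.prod_restrict, integral_prod_symm _ hJi]
  have hdiff := ae_polar_of_ae (measurableSet_of_differentiableAt ℝ g)
    (hg.ae_differentiableAt (μ := volume))
  rw [Measure.volume_eq_prod, ← Measure.prod_restrict] at hdiff
  have hdiff' := Measure.ae_ae_of_ae_prod
    (Measure.measurePreserving_swap.quasiMeasurePreserving.ae hdiff)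
  have hpc : Continuous fun θ => polarPoint (R, θ) := continuous_polarPoint.comp (by fun_prop)
  have hbd : ∫ x in sphere (0 : Eu 2) R, g x ^ 2 ∂(μH[1]) ≤
      R * ∫ θ in Set.Ioo (-π) π, g (polarPoint (R, θ)) ^ 2 := by
    have hint : Integrable (fun x => g x ^ 2)
        ((volume.restrict (Set.Ioc (-π) π)).map fun θ => polarPoint (R, θ)) := by
      rw [integrable_map_measure (by fun_prop) hpc.aemeasurable]
      exact ((hgc.comp hpc).pow 2).integrableOn_Ioc
    refine (integral_mono_measure (hausdorff_circle_le hR) (.of_forall fun x => sq_nonneg _)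
      (hint.smul_measure ENNReal.ofReal_ne_top)).trans_eq ?_
    rw [integral_smul_measure, integral_map hpc.aemeasurable (by fun_prop),
      ENNReal.toReal_ofReal hR.le, integral_Ioc_eq_integral_Ioo, smul_eq_mul]
  refine (mul_le_mul_of_nonneg_left hbd hβ).trans ?_
  rw [← mul_assoc, ← integral_const_mul]
  refine integral_mono_ae ?_ hJi.integral_prod_right ?_
  · exact ((((hgc.comp hpc).pow 2).const_mul _).integrableOn_Icc).mono_set Set.Ioo_subset_Icc_self
  filter_upwards [hdiff'] with θ hθ
  have hline : ∀ r, HasDerivAt (fun r : ℝ => polarPoint (r, θ)) (polarPoint (1, θ)) r := fun r => by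
    have : (fun r : ℝ => polarPoint (r, θ)) = fun r => r • polarPoint (1, θ) :=
      funext fun r => polarPoint_eq_smul r θ
    rw [this]
    simpa using (hasDerivAt_id r).smul_const (polarPoint (1, θ))
  have hlip : LipschitzWith 1 fun r : ℝ => polarPoint (r, θ) :=
    LipschitzWith.of_dist_le_mul fun a b => by
      rw [polarPoint_eq_smul a, polarPoint_eq_smul b, dist_eq_norm, ← sub_smul, norm_smul,
        norm_polarPoint, Real.dist_eq]
      simp
  refine bessel_ray_inequality hc hR hrobin (v := fun r => g (polarPoint (r, θ)))
    (D := fun r => ‖fderiv ℝ g (polarPoint (r, θ))‖ ^ 2) (hg.comp hlip) ?_ (hJs θ)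
  rw [ae_restrict_iff' measurableSet_Ioi] at hθ
  filter_upwards [hθ] with r hr hrm
  refine ⟨_, (hr hrm.1).hasFDerivAt.comp_hasDerivAt r (hline r), ?_⟩
  rw [← sq_abs, ← Real.norm_eq_abs]
  refine pow_le_pow_left₀ (norm_nonneg _) ?_ 2
  simpa [norm_polarPoint] using (fderiv ℝ g (polarPoint (r, θ))).le_opNorm (polarPoint (1, θ))

lemma neg_le_robinEig_ball {c R β : ℝ} (hc : 0 ≤ c) (hR : 0 < R) (hβ : 0 ≤ β)
    (hrobin : 2 * (c * R ^ 2) * besselSeries 1 (c * R ^ 2) = β * R * besselSeries 0 (c * R ^ 2)) :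
    -(4 * c) ≤ robinEig 2 (-β) (ball (0 : Eu 2) R) := by
  refine le_csInf ⟨_, fun _ => 1, 0, (LipschitzWith.const 1).lipschitzOnWith, ?_, rfl⟩ ?_
  · simp only [one_pow, integral_const, smul_eq_mul, mul_one]
    rw [measureReal_restrict_apply_univ]
    exact (ENNReal.toReal_pos (measure_ball_pos volume _ hR).ne' measure_ball_lt_top.ne).ne'
  rintro _ ⟨u, K, hu, h0, rfl⟩
  have hpos : 0 < ∫ x in ball (0 : Eu 2) R, u x ^ 2 :=
    lt_of_le_of_ne (integral_nonneg fun x => sq_nonneg _) (Ne.symm h0)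
  rw [le_div_iff₀ hpos]
  obtain ⟨g, hg, hug⟩ := hu.extend_real
  rw [closure_ball _ hR.ne'] at hug
  have key := robin_form_ball_lower hc hR hβ hrobin hg
  have e1 : ∫ x in ball (0 : Eu 2) R, ‖fderiv ℝ u x‖ ^ 2 =
      ∫ x in ball (0 : Eu 2) R, ‖fderiv ℝ g x‖ ^ 2 :=
    setIntegral_congr_fun measurableSet_ball fun x hx => by
      have : u =ᶠ[nhds x] g := by
        filter_upwards [isOpen_ball.mem_nhds hx] with y hy
        exact hug (ball_subset_closedBall hy)
      simp only [this.fderiv_eq]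
  have e2 : ∫ x in ball (0 : Eu 2) R, u x ^ 2 = ∫ x in ball (0 : Eu 2) R, g x ^ 2 :=
    setIntegral_congr_fun measurableSet_ball fun x hx => by
      simp only [hug (ball_subset_closedBall hx)]
  have e3 : ∫ x in sphere (0 : Eu 2) R, u x ^ 2 ∂(μH[1]) =
      ∫ x in sphere (0 : Eu 2) R, g x ^ 2 ∂(μH[1]) :=
    setIntegral_congr_fun isClosed_sphere.measurableSet fun x hx => by
      simp only [hug (sphere_subset_closedBall hx)]
  rw [frontier_ball _ hR.ne', show ((2 : ℕ) : ℝ) - 1 = 1 by norm_num, e1, e2, e3]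
  linarith

theorem annuli_below_disk_uniformly_for_small_alpha
    (r₃ : ℝ) (hr₃ : 0 < r₃) :
    ∃ αs : ℝ, αs < 0 ∧
      ∀ r₁ r₂ : ℝ, 0 < r₁ → r₁ < r₂ → r₂ ^ 2 - r₁ ^ 2 = r₃ ^ 2 →
        ∀ α ∈ Set.Icc αs (0 : ℝ),
          nrEig α r₁ r₂ ≤ robinEig 2 α (Metric.ball (0 : Eu 2) r₃) := by
  refine ⟨-(1 / (6 * r₃)), by simpa using hr₃, fun r₁ r₂ h₁ h₁₂ harea α hα => ?_⟩
  obtain ⟨β, rfl⟩ : ∃ β, α = -β := ⟨-α, by ring⟩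
  have hβ : 0 ≤ β := by linarith [hα.2]
  have hβr : β * r₃ ≤ 1 / 6 := by
    have : β ≤ 1 / (6 * r₃) := by linarith [hα.1]
    calc β * r₃ ≤ 1 / (6 * r₃) * r₃ := by gcongr
      _ = 1 / 6 := by field_simp
  obtain ⟨z, hz, hrobin, hzβ⟩ := exists_bessel_robin ⟨by positivity, hβr⟩
  set c := z / r₃ ^ 2 with hc
  have hc0 : 0 ≤ c := div_nonneg hz.1 (by positivity)
  have hcz : z = c * r₃ ^ 2 := by rw [hc]; field_simp
  rw [hcz] at hrobin hzβ
  refine le_trans ?_ (neg_le_robinEig_ball hc0 hr₃ hβ hrobin)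
  have hcβ : c * r₃ ≤ β := le_of_mul_le_mul_right (by linarith) hr₃
  rcases le_total r₂ (2 * r₃) with h | h
  · refine nrEig_le_of_bessel hβ hc0 h₁ h₁₂ hr₃ harea hrobin ?_
    have h2 : 0 < r₂ := h₁.trans h₁₂
    have h6 : c * r₃ ^ 2 ≤ 1 / 6 := hcz ▸ hz.2
    calc 2 * c ^ 2 * r₃ ^ 2 * (r₂ + r₃) = 2 * c * (c * r₃ ^ 2) * (r₂ + r₃) := by ring
      _ ≤ 2 * c * (1 / 6) * (2 * r₃ + r₃) := by gcongr
      _ = c * r₃ := by ring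
      _ ≤ β := hcβ
  · refine (nrEig_le_of_const (by linarith) h₁ h₁₂).trans ?_
    rw [harea, div_le_iff₀ (by positivity)]
    nlinarith [mul_le_mul_of_nonneg_left h hβ, mul_le_mul_of_nonneg_right hcβ hr₃.le]

end
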